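/- A class 𝒞 of graphs is nowhere dense if and only if 𝒞 is uniformly quasi-wide. -/

import Mathlib

open SimpleGraph

variable {V : Type} {W : Type}

/-- The set of vertices at distance at most `r` from `v` in `G`. -/
def ball (G : SimpleGraph V) (r : ℕ) (v : V) : Set V :=
  {u | ∃ p : G.Walk v u, p.length ≤ r}

/-- `G` has radius at most `r`. -/
def hasRadiusLE (G : SimpleGraph V) (r : ℕ) : Prop :=
  ∃ u : V, ∀ v : V, ∃ p : G.Walk u v, p.length ≤ r

/-- `H` is a depth-`r` minor of `G`: there are pairwise disjoint branch sets of
radius at most `r`, one for each vertex of `H`, connected appropriately. -/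
def IsDepthMinor (r : ℕ) (H : SimpleGraph W) (G : SimpleGraph V) : Prop :=
  ∃ φ : W → Set V,
    (∀ w : W, hasRadiusLE (G.induce (φ w)) r) ∧
    (Pairwise fun w w' => Disjoint (φ w) (φ w')) ∧
    (∀ a b : W, H.Adj a b → ∃ u ∈ φ a, ∃ v ∈ φ b, G.Adj u v)

/-- `H` is a minor of `G` (no restriction on the radius of branch sets). -/
def IsMinorOf (H : SimpleGraph W) (G : SimpleGraph V) : Prop :=
  ∃ φ : W → Set V,
    (∀ w : W, (G.induce (φ w)).Connected) ∧
    (Pairwise fun w w' => Disjoint (φ w) (φ w')) ∧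
    (∀ a b : W, H.Adj a b → ∃ u ∈ φ a, ∃ v ∈ φ b, G.Adj u v)

/-- A bundled finite graph. -/
structure FGraph : Type 1 where
  V : Type
  [fintypeV : Fintype V]
  G : SimpleGraph V

attribute [instance] FGraph.fintypeV

/-- A class of graphs is nowhere dense if for every `r` there is `m` such that
`K_m` is not a depth-`r` minor of any member. -/
def NowhereDense (C : Set FGraph) : Prop :=
  ∀ r : ℕ, ∃ m : ℕ, ∀ G ∈ C, ¬ IsDepthMinor r (⊤ : SimpleGraph (Fin m)) G.G

/-- A class of graphs has bounded expansion if for every `r` the edge density of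
depth-`r` minors of members is bounded. -/
def BoundedExpansion (C : Set FGraph) : Prop :=
  ∀ r : ℕ, ∃ d : ℝ, ∀ G ∈ C, ∀ (n : ℕ) (H : SimpleGraph (Fin n)),
    IsDepthMinor r H G.G → (H.edgeSet.ncard : ℝ) / (n : ℝ) ≤ d

/-- `H` is (isomorphic to) a subgraph of `G`. -/
def IsSubgraphOf (H G : FGraph) : Prop :=
  ∃ f : H.V → G.V, Function.Injective f ∧ ∀ a b : H.V, H.G.Adj a b → G.G.Adj (f a) (f b)

/-- `N_r^{G-S}(v)`, the ball of radius `r` around `v` in `G - S`, as a subset of `V`. -/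
def ballAvoiding (G : SimpleGraph V) (S : Set V) (r : ℕ) (v : V) : Set V :=
  {u | ∃ p : G.Walk v u, p.length ≤ r ∧ ∀ x ∈ p.support, x ∉ S}

/-- `B` is distance-`r` independent in `G - S`: distinct vertices of `B` have
distance greater than `r` in `G - S`. -/
def DistIndepIn (G : SimpleGraph V) (S : Set V) (r : ℕ) (B : Set V) : Prop :=
  ∀ u ∈ B, ∀ v ∈ B, u ≠ v →
    ∀ p : G.Walk u v, (∀ x ∈ p.support, x ∉ S) → r < p.length

/-- Uniform quasi-wideness. -/
def UniformlyQuasiWide (C : Set FGraph) : Prop :=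
  ∀ r : ℕ, ∃ s : ℕ, ∀ m : ℕ, ∃ N : ℕ, ∀ G ∈ C, ∀ A : Set G.V,
    N ≤ A.ncard → ∃ S : Set G.V, S.ncard ≤ s ∧
      ∃ B ⊆ A \ S, m ≤ B.ncard ∧ DistIndepIn G.G S r B

/-- Splitter wins the simple `ℓ`-round radius-`r` splitter game on `G`. -/
def SplitterWins (r : ℕ) : (ℓ : ℕ) → (V : Type) → SimpleGraph V → Prop
  | 0, V, _ => IsEmpty V
  | (ℓ + 1), _, G =>
      ∀ C : G.Subgraph, hasRadiusLE C.coe r →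
        ∃ w ∈ C.verts, SplitterWins r ℓ _ ((C.deleteVerts {w}).coe)

/-- Splitter wins the `ℓ`-round treedepth game on `G`. -/
def TDSplitterWins : (ℓ : ℕ) → (V : Type) → SimpleGraph V → Prop
  | 0, V, _ => IsEmpty V
  | (ℓ + 1), _, G =>
      ∀ c : G.ConnectedComponent, ∃ w ∈ c.supp,
        TDSplitterWins ℓ _ (G.induce (c.supp \ {w}))

/-- Splitter wins the variant of the `ℓ`-round radius-`r` splitter game in which
she may delete up to `m` vertices per round. -/
def SplitterWinsSets (r m : ℕ) : (ℓ : ℕ) → (V : Type) → SimpleGraph V → Prop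
  | 0, V, _ => IsEmpty V
  | (ℓ + 1), _, G =>
      ∀ C : G.Subgraph, hasRadiusLE C.coe r →
        ∃ W ⊆ C.verts, W.ncard ≤ m ∧ SplitterWinsSets r m ℓ _ ((C.deleteVerts W).coe)

/-- `le` is the ancestor order of a rooted forest: a partial order in which the
set of ancestors of any element is a chain. -/
def IsForestOrder (le : V → V → Prop) : Prop :=
  (∀ v, le v v) ∧ (∀ u v w, le u v → le v w → le u w) ∧
  (∀ u v, le u v → le v u → u = v) ∧
  (∀ v u w, le u v → le w v → le u w ∨ le w u)

/-- `G` has treedepth at most `ℓ`: there is a rooted forest of depth at most `ℓ`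
on `V(G)` such that every edge joins an ancestor-descendant pair. -/
def TreedepthLE (G : SimpleGraph V) (ℓ : ℕ) : Prop :=
  ∃ le : V → V → Prop, IsForestOrder le ∧
    (∀ u v, G.Adj u v → le u v ∨ le v u) ∧
    ∀ v, ({u | le u v}).ncard ≤ ℓ

/-- The treedepth of `G`. -/
noncomputable def treedepth (G : SimpleGraph V) : ℕ := sInf {ℓ | TreedepthLE G ℓ}

/-- `WReach G le r v`: the set of vertices weakly `r`-reachable from `v`
with respect to the linear order `le`. -/
def WReach (G : SimpleGraph V) (le : V → V → Prop) (r : ℕ) (v : V) : Set V :=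
  {u | le u v ∧ ∃ p : G.Walk u v, p.IsPath ∧ p.length ≤ r ∧
    ∀ x ∈ p.support, x ≠ u → x ≠ v → le u x ∧ u ≠ x}

/-- `WReachInf G le v`: the set of vertices weakly reachable from `v`
with respect to the linear order `le` (no bound on path length). -/
def WReachInf (G : SimpleGraph V) (le : V → V → Prop) (v : V) : Set V :=
  {u | le u v ∧ ∃ p : G.Walk u v, p.IsPath ∧
    ∀ x ∈ p.support, x ≠ u → x ≠ v → le u x ∧ u ≠ x}

/-- The weak `r`-coloring number of `G`. -/
noncomputable def wcol (G : SimpleGraph V) (r : ℕ) : ℕ :=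
  sInf {k | ∃ le : V → V → Prop, IsLinearOrder V le ∧ ∀ v, (WReach G le r v).ncard ≤ k}

/-- The coloring number of `G`: the least `k` such that some linear order has
every vertex with at most `k - 1` smaller neighbors. -/
noncomputable def coloringNumber (G : SimpleGraph V) : ℕ :=
  sInf {k | ∃ le : V → V → Prop, IsLinearOrder V le ∧
    ∀ v, ({u | G.Adj u v ∧ le u v ∧ u ≠ v}).ncard + 1 ≤ k}

/-- `X` is an `r`-neighborhood cover of `G` with clusters of radius at most `ρ`:
each cluster induces a connected subgraph of radius at most `ρ`, and every
`r`-ball is contained in some cluster. -/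
def IsNbhdCover (G : SimpleGraph V) (r ρ : ℕ) (X : Set (Set V)) : Prop :=
  (∀ C ∈ X, hasRadiusLE (G.induce C) ρ) ∧ ∀ v : V, ∃ C ∈ X, ball G r v ⊆ C

/-- The cluster `X_r[G,π,u] = {w : u ∈ WReach_r[G,π,w]}`. -/
def XCluster (G : SimpleGraph V) (le : V → V → Prop) (r : ℕ) (u : V) : Set V :=
  {w | u ∈ WReach G le r w}

/-- The smaller endpoint of an edge. -/
def sym2Min {n : ℕ} (e : Sym2 (Fin n)) : Fin n :=
  Sym2.lift ⟨fun a b => min a b, fun _ _ => min_comm _ _⟩ e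

/-- The larger endpoint of an edge. -/
def sym2Max {n : ℕ} (e : Sym2 (Fin n)) : Fin n :=
  Sym2.lift ⟨fun a b => max a b, fun _ _ => max_comm _ _⟩ e

/-- The relation generating the `r`-subdivision of `G`. -/
def SubdivRel {n : ℕ} (r : ℕ) (G : SimpleGraph (Fin n)) :
    (Fin n ⊕ (G.edgeSet × Fin r)) → (Fin n ⊕ (G.edgeSet × Fin r)) → Prop
  | Sum.inl a, Sum.inl b => r = 0 ∧ G.Adj a b
  | Sum.inl a, Sum.inr ei => ((ei.2 : ℕ) = 0 ∧ a = sym2Min ei.1.1) ∨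
      ((ei.2 : ℕ) = r - 1 ∧ a = sym2Max ei.1.1)
  | Sum.inr ei, Sum.inr ej => ei.1 = ej.1 ∧ (ei.2 : ℕ) + 1 = (ej.2 : ℕ)
  | Sum.inr _, Sum.inl _ => False

/-- The `r`-subdivision of `G`: every edge is replaced by a path with `r`
internal vertices. -/
def Subdivision {n : ℕ} (r : ℕ) (G : SimpleGraph (Fin n)) :
    SimpleGraph ((Fin n) ⊕ (G.edgeSet × Fin r)) :=
  SimpleGraph.fromRel (SubdivRel r G)

/-- Ramsey's theorem for graphs. -/
theorem exists_ramsey (a b : ℕ) :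
    ∃ N : ℕ, ∀ {α : Type} (P : α → α → Prop), (∀ x y, P x y → P y x) →
      ∀ I : Finset α, N ≤ I.card →
      (∃ Q ⊆ I, a ≤ Q.card ∧ ∀ x ∈ Q, ∀ y ∈ Q, x ≠ y → P x y) ∨
      (∃ Q ⊆ I, b ≤ Q.card ∧ ∀ x ∈ Q, ∀ y ∈ Q, x ≠ y → ¬ P x y) := by
  classical
  induction a generalizing b with
  | zero => exact ⟨0, fun P _ I _ => Or.inl ⟨∅, by simp⟩⟩
  | succ a iha =>
    induction b with
    | zero => exact ⟨0, fun P _ I _ => Or.inr ⟨∅, by simp⟩⟩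
    | succ b ihb =>
      obtain ⟨N₁, h₁⟩ := iha (b + 1)
      obtain ⟨N₂, h₂⟩ := ihb
      refine ⟨N₁ + N₂ + 1, fun {α} P hP I hI => ?_⟩
      obtain ⟨v, hv⟩ : I.Nonempty := Finset.card_pos.1 (by omega)
      have hcard := Finset.card_filter_add_card_filter_not (s := I.erase v) (P v)
      rw [Finset.card_erase_of_mem hv] at hcard
      have hsub : ∀ Q ⊆ I.erase v, Q ⊆ I := fun Q hQ => hQ.trans (Finset.erase_subset _ _)
      have hins : ∀ Q ⊆ I.erase v, (insert v Q).card = Q.card + 1 :=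
        fun Q hQ => Finset.card_insert_of_notMem fun h => by simpa using hQ h
      by_cases hc : N₁ ≤ ((I.erase v).filter (P v)).card
      · obtain ⟨Q, hQ, hQc, hQP⟩ | ⟨Q, hQ, hQc, hQP⟩ := h₁ P hP _ hc
        · refine Or.inl ⟨insert v Q, Finset.insert_subset hv
            (hsub _ (hQ.trans (Finset.filter_subset _ _))), ?_, ?_⟩
          · rw [hins _ (hQ.trans (Finset.filter_subset _ _))]; omega
          · have hvQ : ∀ y ∈ Q, P v y := fun y hy => (Finset.mem_filter.1 (hQ hy)).2
            intro x hx y hy hxy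
            obtain hx' | hx' := Finset.mem_insert.1 hx <;>
              obtain hy' | hy' := Finset.mem_insert.1 hy
            · exact absurd (hx'.trans hy'.symm) hxy
            · exact hx' ▸ hvQ _ hy'
            · exact hy' ▸ hP _ _ (hvQ _ hx')
            · exact hQP _ hx' _ hy' hxy
        · exact Or.inr ⟨Q, hsub _ (hQ.trans (Finset.filter_subset _ _)), hQc, hQP⟩
      · obtain ⟨Q, hQ, hQc, hQP⟩ | ⟨Q, hQ, hQc, hQP⟩ :=
          h₂ P hP ((I.erase v).filter fun y => ¬ P v y) (by omega)
        · exact Or.inl ⟨Q, hsub _ (hQ.trans (Finset.filter_subset _ _)), hQc, hQP⟩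
        · refine Or.inr ⟨insert v Q, Finset.insert_subset hv
            (hsub _ (hQ.trans (Finset.filter_subset _ _))), ?_, ?_⟩
          · rw [hins _ (hQ.trans (Finset.filter_subset _ _))]; omega
          · have hvQ : ∀ y ∈ Q, ¬ P v y := fun y hy => (Finset.mem_filter.1 (hQ hy)).2
            intro x hx y hy hxy
            obtain hx' | hx' := Finset.mem_insert.1 hx <;>
              obtain hy' | hy' := Finset.mem_insert.1 hy
            · exact absurd (hx'.trans hy'.symm) hxy
            · exact hx' ▸ hvQ _ hy'
            · exact hy' ▸ fun h => hvQ _ hx' (hP _ _ h)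
            · exact hQP x (by assumption) y (by assumption) hxy

/-- A set mapping on pairs with values of size at most `d` has a free `k`-tuple. -/
theorem exists_free_tuple {α : Type} [Fintype α] [DecidableEq α] (k d : ℕ)
    (hα : k ^ 3 * d < Fintype.card α) (D : α → α → Finset α) (hD : ∀ a b, (D a b).card ≤ d) :
    ∃ g : Fin k → α, ∀ i j l, l ≠ i → l ≠ j → g l ∉ D (g i) (g j) := by
  by_contra! hbad
  set n := Fintype.card α with hn
  let T : Finset (Fin k × Fin k × Fin k) := Finset.univ.filter fun t => t.2.2 ≠ t.1 ∧ t.2.2 ≠ t.2.1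
  let B : Fin k × Fin k × Fin k → Finset (Fin k → α) := fun t =>
    Finset.univ.filter fun g => g t.2.2 ∈ D (g t.1) (g t.2.1)
  have hB : ∀ t ∈ T, (B t).card * n ≤ n ^ k * d := by
    rintro ⟨i, j, l⟩ ht
    obtain ⟨hi, hj⟩ : l ≠ i ∧ l ≠ j := by simpa [T] using ht
    calc (B (i, j, l)).card * n = (B (i, j, l) ×ˢ (Finset.univ : Finset α)).card := by
          rw [Finset.card_product, Finset.card_univ]
      _ ≤ ((Finset.univ : Finset (Fin k → α)).sigma fun g => D (g i) (g j)).card := by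
          refine Finset.card_le_card_of_injOn
            (fun p => (⟨Function.update p.1 l p.2, p.1 l⟩ : Σ _ : Fin k → α, α)) ?_ ?_
          · rintro ⟨g, c⟩ hg
            have : g l ∈ D (g i) (g j) := by simpa [B] using hg
            simpa [Function.update_of_ne hi.symm, Function.update_of_ne hj.symm] using this
          · rintro ⟨g, c⟩ - ⟨g', c'⟩ - h
            simp only [Sigma.mk.injEq, heq_eq_eq] at h
            obtain ⟨h1, h2⟩ := h
            have h3 := congrFun h1
            refine Prod.ext (funext fun x => ?_) (by simpa using h3 l)
            by_cases hx : x = l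
            · subst hx; exact h2
            · simpa [hx] using h3 x
      _ = ∑ g : Fin k → α, (D (g i) (g j)).card := Finset.card_sigma _ _
      _ ≤ ∑ _g : Fin k → α, d := Finset.sum_le_sum fun g _ => hD _ _
      _ = n ^ k * d := by simp [hn]
  have hcover : (Finset.univ : Finset (Fin k → α)) ⊆ T.biUnion B := by
    intro g _
    obtain ⟨i, j, l, hi, hj, h⟩ := hbad g
    exact Finset.mem_biUnion.2 ⟨(i, j, l), by simp [T, hi, hj], by simpa [B] using h⟩
  have hT : T.card ≤ k ^ 3 := by
    refine (Finset.card_le_univ _).trans (le_of_eq ?_)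
    simp only [Fintype.card_prod, Fintype.card_fin]; ring
  have hpos : 0 < n := by omega
  have h1 : n ^ k * n ≤ n ^ k * (k ^ 3 * d) := calc
    n ^ k * n = (Finset.univ : Finset (Fin k → α)).card * n := by simp [hn]
    _ ≤ (∑ t ∈ T, (B t).card) * n :=
        Nat.mul_le_mul_right _ ((Finset.card_le_card hcover).trans Finset.card_biUnion_le)
    _ = ∑ t ∈ T, (B t).card * n := Finset.sum_mul _ _ _
    _ ≤ ∑ _t ∈ T, n ^ k * d := Finset.sum_le_sum hB
    _ = T.card * (n ^ k * d) := by simp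
    _ ≤ k ^ 3 * (n ^ k * d) := Nat.mul_le_mul_right _ hT
    _ = n ^ k * (k ^ 3 * d) := by ring
  exact absurd (Nat.le_of_mul_le_mul_left h1 (pow_pos hpos k)) (by omega)

/-- The `1`-subdivision of `K_k`, with branch vertices in `I`, embeds in the bipartite graph
given by the relation `R`. -/
def HasSubdividedClique {α W : Type} (R : α → W → Prop) (I : Finset α) (k : ℕ) : Prop :=
  ∃ (g : Fin k → α) (b : Fin k → Fin k → W), Function.Injective g ∧ (∀ i, g i ∈ I) ∧
    (∀ i j, i < j → R (g i) (b i j) ∧ R (g j) (b i j)) ∧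
    ∀ i j i' j', i < j → i' < j' → b i j = b i' j' → i = i' ∧ j = j'

theorem HasSubdividedClique.mono {α W : Type} {R : α → W → Prop} {I J : Finset α} {k : ℕ}
    (h : HasSubdividedClique R I k) (hIJ : I ⊆ J) : HasSubdividedClique R J k := by
  obtain ⟨g, b, hg, hgI, h⟩ := h
  exact ⟨g, b, hg, fun i => hIJ (hgI i), h⟩

/-- If any two elements of a large set `Q` have a common neighbour outside `S`, and no vertex
outside `S` has `d` neighbours in `Q`, then there is a subdivided clique. -/
theorem hasSubdividedClique_of_degree_lt {α W : Type} [DecidableEq α] (R : α → W → Prop)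
    [∀ a w, Decidable (R a w)] (Q : Finset α) (S : Finset W) (k d : ℕ)
    (hQ : k ^ 3 * (d + 1) < Q.card)
    (hcommon : ∀ x ∈ Q, ∀ y ∈ Q, x ≠ y → ∃ w ∉ S, R x w ∧ R y w)
    (hdeg : ∀ w ∉ S, (Q.filter fun a => R a w).card ≤ d) : HasSubdividedClique R Q k := by
  obtain rfl | hk := Nat.eq_zero_or_pos k
  · exact ⟨Fin.elim0, Fin.elim0, fun i => i.elim0, fun i => i.elim0, fun i => i.elim0,
      fun i => i.elim0⟩
  have hk3 : 1 * 1 ≤ k ^ 3 * (d + 1) := Nat.mul_le_mul (Nat.one_le_pow _ _ hk) (by omega)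
  obtain ⟨x₀, hx₀, y₀, hy₀, hxy₀⟩ := Finset.one_lt_card.1 (show 1 < Q.card by omega)
  have : Nonempty W := ⟨(hcommon x₀ hx₀ y₀ hy₀ hxy₀).choose⟩
  choose! f hfS hfl hfr using hcommon
  let D : Q → Q → Finset Q := fun a b =>
    insert a (if a = b then ∅ else Finset.univ.filter fun c => R c (f a b))
  have hD : ∀ a b, (D a b).card ≤ d + 1 := by
    intro a b
    refine (Finset.card_insert_le _ _).trans (Nat.succ_le_succ ?_)
    split_ifs with hab
    · simp
    · refine le_trans ?_ (hdeg _ (hfS a a.2 b b.2 fun h => hab (Subtype.ext h)))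
      refine Finset.card_le_card_of_injOn Subtype.val ?_ Subtype.val_injective.injOn
      intro c hc
      simpa using hc
  obtain ⟨g, hg⟩ := exists_free_tuple k (d + 1) (by simpa using hQ) D hD
  have hinj : Function.Injective g := by
    intro l i h
    by_contra hli
    exact hg i i l hli hli (by simp [D, h])
  have hne : ∀ i j, i < j → (g i : α) ≠ g j := fun i j hij h =>
    hij.ne (hinj (Subtype.ext h))
  have hmem : ∀ i j l, i < j → R (g l) (f (g i) (g j)) → l = i ∨ l = j := by
    intro i j l hij h
    by_contra! hl
    refine hg i j l hl.1 hl.2 ?_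
    simp [D, hinj.ne hij.ne, h]
  have hl : ∀ i j, i < j → R (g i) (f (g i) (g j)) := fun i j hij =>
    hfl _ (g i).2 _ (g j).2 (hne i j hij)
  have hr : ∀ i j, i < j → R (g j) (f (g i) (g j)) := fun i j hij =>
    hfr _ (g i).2 _ (g j).2 (hne i j hij)
  refine ⟨fun i => g i, fun i j => f (g i) (g j), Subtype.val_injective.comp hinj,
    fun i => (g i).2, fun i j hij => ⟨hl i j hij, hr i j hij⟩, fun i j i' j' hij hij' h => ?_⟩
  have h1 := hmem i j i' hij (by have := hl i' j' hij'; simp only at h; rwa [← h] at this)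
  have h2 := hmem i j j' hij (by have := hr i' j' hij'; simp only at h; rwa [← h] at this)
  omega

/-- Either the bipartite graph given by `R` contains a subdivided `K_k`, or a large subset of `I`
has pairwise disjoint neighbourhoods after removing a bounded number of vertices. -/
theorem exists_subdividedClique_or_disjoint_nbhds (k m : ℕ) :
    ∃ N : ℕ, ∀ {α W : Type} (R : α → W → Prop) (I : Finset α), N ≤ I.card →
      HasSubdividedClique R I k ∨
      ∃ S : Finset W, S.card ≤ k * k ∧ ∃ J ⊆ I, m ≤ J.card ∧
        ∀ a ∈ J, ∀ a' ∈ J, a ≠ a' → ∀ w ∉ S, R a w → ¬ R a' w := by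
  classical
  suffices H : ∀ t : ℕ, ∃ N : ℕ, ∀ {α W : Type} (R : α → W → Prop) (I : Finset α) (S : Finset W),
      S.card + t = k * k → (∀ a ∈ I, ∀ w ∈ S, R a w) → N ≤ I.card →
      HasSubdividedClique R I k ∨
      ∃ S : Finset W, S.card ≤ k * k ∧ ∃ J ⊆ I, m ≤ J.card ∧
        ∀ a ∈ J, ∀ a' ∈ J, a ≠ a' → ∀ w ∉ S, R a w → ¬ R a' w by
    obtain ⟨N, hN⟩ := H (k * k)
    exact ⟨N, fun R I hI => hN R I ∅ (by simp) (by simp) hI⟩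
  intro t
  induction t with
  | zero =>
    refine ⟨k, fun {α W} R I S hS hR hI => Or.inl ?_⟩
    obtain ⟨g⟩ : Nonempty (Fin k ↪ I) := Function.Embedding.nonempty_of_card_le (by simpa using hI)
    obtain ⟨b⟩ : Nonempty (Fin k × Fin k ↪ S) :=
      Function.Embedding.nonempty_of_card_le (by simp; omega)
    refine ⟨fun i => g i, fun i j => b (i, j), Subtype.val_injective.comp g.injective,
      fun i => (g i).2, fun i j _ => ⟨hR _ (g i).2 _ (b _).2, hR _ (g j).2 _ (b _).2⟩,
      fun i j i' j' _ _ h => ?_⟩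
    simpa using b.injective (Subtype.ext h)
  | succ t ih =>
    obtain ⟨d, hd⟩ := ih
    obtain ⟨N, hN⟩ := exists_ramsey (k ^ 3 * (d + 1) + 1) m
    refine ⟨N, fun {α W} R I S hS hR hI => ?_⟩
    obtain ⟨Q, hQI, hQ, hQR⟩ | ⟨J, hJI, hJ, hJR⟩ :=
      hN (fun x y => ∃ w ∉ S, R x w ∧ R y w) (fun x y ⟨w, hw, hx, hy⟩ => ⟨w, hw, hy, hx⟩) I hI
    · by_cases hdeg : ∃ w ∉ S, d ≤ (Q.filter fun a => R a w).card
      · obtain ⟨w, hw, hdw⟩ := hdeg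
        have hsub := (Finset.filter_subset (fun a => R a w) Q).trans hQI
        obtain h | ⟨S', hS', J, hJ, h⟩ := hd R (Q.filter fun a => R a w) (insert w S)
          (by rw [Finset.card_insert_of_notMem hw]; omega) (by
            intro a ha v hv
            obtain rfl | hv := Finset.mem_insert.1 hv
            · exact (Finset.mem_filter.1 ha).2
            · exact hR a (hsub ha) v hv) hdw
        · exact Or.inl (h.mono hsub)
        · exact Or.inr ⟨S', hS', J, hJ.trans hsub, h⟩
      · push Not at hdeg
        exact Or.inl ((hasSubdividedClique_of_degree_lt R Q S k d hQ hQR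
          fun w hw => (hdeg w hw).le).mono hQI)
    · exact Or.inr ⟨S, by omega, J, hJI, hJ, fun a ha b hb hne w hw h₁ h₂ =>
        hJR a ha b hb hne ⟨w, hw, h₁, h₂⟩⟩
/-- An induced subgraph has radius at most `r` iff some vertex reaches all others by walks of length
at most `r` inside the inducing set. -/
theorem hasRadiusLE_induce_iff (G : SimpleGraph V) (r : ℕ) (X : Set V) :
    hasRadiusLE (G.induce X) r ↔
      ∃ c ∈ X, ∀ u ∈ X, ∃ p : G.Walk c u, p.length ≤ r ∧ ∀ x ∈ p.support, x ∈ X := by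
  constructor
  · rintro ⟨c, hc⟩
    refine ⟨c, c.2, fun u hu => ?_⟩
    obtain ⟨p, hp⟩ := hc ⟨u, hu⟩
    have hX : ∀ x ∈ (p.map (Embedding.induce X).toHom).support, x ∈ X := by
      intro x hx
      rw [Walk.support_map, List.mem_map] at hx
      obtain ⟨y, -, rfl⟩ := hx
      exact y.2
    exact ⟨p.map (Embedding.induce X).toHom, (p.length_map _).trans_le hp, hX⟩
  · rintro ⟨c, hcX, hc⟩
    refine ⟨⟨c, hcX⟩, fun u => ?_⟩
    obtain ⟨p, hp, hpX⟩ := hc u u.2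
    refine ⟨p.induce X hpX, ?_⟩
    rwa [← Walk.length_map (Embedding.induce X).toHom, Walk.map_induce]

theorem mem_ballAvoiding_self {G : SimpleGraph V} {S : Set V} {v : V} (r : ℕ) (hv : v ∉ S) :
    v ∈ ballAvoiding G S r v := ⟨Walk.nil, by simp, by simpa using hv⟩

theorem getVert_mem_ballAvoiding {G : SimpleGraph V} {S : Set V} {u v : V} (p : G.Walk u v)
    (hp : ∀ x ∈ p.support, x ∉ S) {n r : ℕ} (hn : min n p.length ≤ r) :
    p.getVert n ∈ ballAvoiding G S r u :=
  ⟨p.take n, by rwa [Walk.take_length], fun x hx => hp x ((p.isSubwalk_take n).support_subset hx)⟩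

theorem getVert_mem_ballAvoiding_end {G : SimpleGraph V} {S : Set V} {u v : V} (p : G.Walk u v)
    (hp : ∀ x ∈ p.support, x ∉ S) {n r : ℕ} (hn : p.length - n ≤ r) :
    p.getVert n ∈ ballAvoiding G S r v :=
  ⟨(p.drop n).reverse, by rwa [Walk.length_reverse, Walk.drop_length], fun x hx =>
    hp x ((p.isSubwalk_drop n).support_subset (by simpa using hx))⟩

theorem exists_adj_of_mem_ballAvoiding_succ {G : SimpleGraph V} {S : Set V} {r : ℕ} {v w : V}
    (hw : w ∈ ballAvoiding G S (r + 1) v) (hw' : w ∉ ballAvoiding G S r v) :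
    ∃ u ∈ ballAvoiding G S r v, G.Adj u w := by
  obtain ⟨p, hp, hpS⟩ := hw
  have hlen : p.length = r + 1 := by
    by_contra h
    exact hw' ⟨p, by omega, hpS⟩
  refine ⟨p.getVert r, getVert_mem_ballAvoiding p hpS (min_le_left _ _), ?_⟩
  have := p.adj_getVert_succ (i := r) (by omega)
  rwa [← hlen, p.getVert_length] at this

/-- Adding neighbours to a ball increases the radius by at most one. -/
theorem hasRadiusLE_ballAvoiding_union (G : SimpleGraph V) (S E : Set V) (r : ℕ) (v : V)
    (hv : v ∉ S) (hE : ∀ e ∈ E, ∃ u ∈ ballAvoiding G S r v, G.Adj u e) :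
    hasRadiusLE (G.induce (ballAvoiding G S r v ∪ E)) (r + 1) := by
  classical
  have hball : ∀ u ∈ ballAvoiding G S r v, ∃ p : G.Walk v u, p.length ≤ r ∧
      ∀ x ∈ p.support, x ∈ ballAvoiding G S r v := by
    rintro u ⟨p, hp, hpS⟩
    refine ⟨p, hp, fun x hx => ⟨p.takeUntil x hx, (p.length_takeUntil_le_length hx).trans hp,
      fun y hy => hpS y (p.support_takeUntil_subset_support hx hy)⟩⟩
  refine (hasRadiusLE_induce_iff _ _ _).2 ⟨v, Or.inl (mem_ballAvoiding_self r hv), ?_⟩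
  rintro u (hu | hu)
  · obtain ⟨p, hp, hpX⟩ := hball u hu
    exact ⟨p, by omega, fun x hx => Or.inl (hpX x hx)⟩
  · obtain ⟨w, hw, hwu⟩ := hE u hu
    obtain ⟨p, hp, hpX⟩ := hball w hw
    refine ⟨p.concat hwu, by simpa using hp, fun x hx => ?_⟩
    rw [Walk.support_concat, List.mem_append, List.mem_singleton] at hx
    obtain hx | rfl := hx
    · exact Or.inl (hpX x hx)
    · exact Or.inr hu

theorem DistIndepIn.mono {G : SimpleGraph V} {S : Set V} {r r' : ℕ} {A B : Set V}
    (h : DistIndepIn G S r A) (hr : r' ≤ r) (hB : B ⊆ A) : DistIndepIn G S r' B :=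
  fun u hu v hv huv p hp => hr.trans_lt (h u (hB hu) v (hB hv) huv p hp)

theorem DistIndepIn.disjoint_ballAvoiding {G : SimpleGraph V} {S : Set V} {r i j : ℕ} {A : Set V}
    (h : DistIndepIn G S r A) (hr : i + j ≤ r) {u v : V} (hu : u ∈ A) (hv : v ∈ A) (huv : u ≠ v) :
    Disjoint (ballAvoiding G S i u) (ballAvoiding G S j v) := by
  rw [Set.disjoint_left]
  rintro x ⟨p, hp, hpS⟩ ⟨q, hq, hqS⟩
  have := h u hu v hv huv (p.append q.reverse) fun y hy => by
    rw [Walk.mem_support_append_iff, Walk.support_reverse, List.mem_reverse] at hy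
    exact hy.elim (hpS y) (hqS y)
  rw [Walk.length_append, Walk.length_reverse] at this
  omega

/-- A set of `k` vertices at pairwise distance exactly `2 * i + 1` yields a shallow `K_k` minor. -/
theorem isDepthMinor_top_of_walks {G : SimpleGraph V} {S : Set V} {i k : ℕ} (g : Fin k → V)
    (hg : Function.Injective g) (hgS : ∀ j, g j ∉ S)
    (hind : DistIndepIn G S (2 * i) (Set.range g))
    (hwalk : ∀ j l, j ≠ l → ∃ p : G.Walk (g j) (g l), p.length ≤ 2 * i + 1 ∧
      ∀ x ∈ p.support, x ∉ S) :
    IsDepthMinor (i + 1) (⊤ : SimpleGraph (Fin k)) G := by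
  refine ⟨fun j => ballAvoiding G S i (g j) ∪ ∅,
    fun j => hasRadiusLE_ballAvoiding_union G S ∅ i (g j) (hgS j) (by simp), fun j l hjl => ?_,
    fun j l hjl => ?_⟩
  · simpa using hind.disjoint_ballAvoiding (by omega) ⟨j, rfl⟩ ⟨l, rfl⟩ (hg.ne hjl)
  · obtain ⟨p, hp, hpS⟩ := hwalk j l hjl
    have hlen := hind _ ⟨j, rfl⟩ _ ⟨l, rfl⟩ (hg.ne hjl) p hpS
    exact ⟨p.getVert i, Or.inl (getVert_mem_ballAvoiding p hpS (min_le_left _ _)),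
      p.getVert (i + 1), Or.inl (getVert_mem_ballAvoiding_end p hpS (by omega)),
      p.adj_getVert_succ (by omega)⟩

/-- A subdivided `K_k` in the incidence relation between far apart vertices and their
`(i + 1)`-balls yields a shallow `K_k` minor. -/
theorem isDepthMinor_top_of_hasSubdividedClique {G : SimpleGraph V} {S : Set V} {i k : ℕ}
    {I : Finset V} (hIS : ∀ a ∈ I, a ∉ S) (hind : DistIndepIn G S (2 * i + 1) I)
    (h : HasSubdividedClique (fun a w => w ∈ ballAvoiding G S (i + 1) a) I k) :
    IsDepthMinor (i + 1) (⊤ : SimpleGraph (Fin k)) G := by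
  obtain ⟨g, b, hg, hgI, hR, hb⟩ := h
  have hball : ∀ a c l, a < c → b a c ∉ ballAvoiding G S i (g l) := by
    intro a c l hac hl
    by_cases hla : l = a
    · have hd := hind.disjoint_ballAvoiding (i := i) (j := i + 1) (by omega) (hgI l) (hgI c)
        (hg.ne (by omega))
      exact Set.disjoint_left.1 hd hl (hR a c hac).2
    · have hd := hind.disjoint_ballAvoiding (i := i) (j := i + 1) (by omega) (hgI l) (hgI a)
        (hg.ne hla)
      exact Set.disjoint_left.1 hd hl (hR a c hac).1
  let E : Fin k → Set V := fun j => {w | ∃ l, j < l ∧ w = b j l}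
  have hedge : ∀ a c, a < c → ∃ u ∈ ballAvoiding G S i (g a) ∪ E a,
      ∃ v ∈ ballAvoiding G S i (g c) ∪ E c, G.Adj u v := by
    intro a c hac
    obtain ⟨u, hu, huw⟩ := exists_adj_of_mem_ballAvoiding_succ (hR a c hac).2 (hball a c c hac)
    exact ⟨b a c, Or.inr ⟨c, hac, rfl⟩, u, Or.inl hu, huw.symm⟩
  refine ⟨fun j => ballAvoiding G S i (g j) ∪ E j,
    fun j => hasRadiusLE_ballAvoiding_union G S (E j) i (g j) (hIS _ (hgI j)) ?_,
    fun j l hjl => ?_, fun j l hjl => ?_⟩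
  · rintro _ ⟨l, hjl, rfl⟩
    exact exists_adj_of_mem_ballAvoiding_succ (hR j l hjl).1 (hball j l j hjl)
  · refine Set.disjoint_left.2 ?_
    rintro x (hx | ⟨c, hc, rfl⟩) (hx' | ⟨d, hd, hx'⟩)
    · exact Set.disjoint_left.1 (hind.disjoint_ballAvoiding (by omega) (hgI j) (hgI l) (hg.ne hjl))
        hx hx'
    · exact hball l d j hd (hx' ▸ hx)
    · exact hball j c l hc hx'
    · exact hjl (hb _ _ _ _ hc hd hx').1
  · obtain h | h := lt_or_gt_of_ne (show j ≠ l from hjl)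
    · exact hedge j l h
    · obtain ⟨u, hu, v, hv, huv⟩ := hedge l j h
      exact ⟨v, hv, u, hu, huv.symm⟩

theorem NowhereDense.exists_distIndepIn {C : Set FGraph} (hC : NowhereDense C) (i : ℕ) :
    ∃ s : ℕ, ∀ m : ℕ, ∃ N : ℕ, ∀ G ∈ C, ∀ A : Finset G.V, N ≤ A.card →
      ∃ S : Finset G.V, S.card ≤ s ∧ ∃ B ⊆ A, Disjoint B S ∧ m ≤ B.card ∧
        DistIndepIn G.G (S : Set G.V) (2 * i) B := by
  classical
  induction i with
  | zero =>
    refine ⟨0, fun m => ⟨m, fun G _ A hA => ⟨∅, by simp, A, subset_rfl, by simp, hA, ?_⟩⟩⟩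
    intro u _ v _ huv p _
    exact Nat.pos_of_ne_zero fun h => huv (Walk.eq_of_length_eq_zero h)
  | succ i ih =>
    obtain ⟨s, hs⟩ := ih
    obtain ⟨k, hk⟩ := hC (i + 1)
    refine ⟨s + k * k, fun m => ?_⟩
    obtain ⟨M, hM⟩ := exists_subdividedClique_or_disjoint_nbhds k (m + k * k)
    obtain ⟨L, hL⟩ := exists_ramsey k M
    obtain ⟨N, hN⟩ := hs L
    refine ⟨N, fun G hG A hA => ?_⟩
    obtain ⟨S, hS, B, hBA, hBS, hB, hind⟩ := hN G hG A hA
    have hBS' : ∀ a ∈ B, a ∉ (S : Set G.V) := fun a ha => Finset.disjoint_left.1 hBS ha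
    obtain ⟨Q, hQB, hQ, hQR⟩ | ⟨J, hJB, hJ, hJR⟩ := hL
      (fun u v => ∃ p : G.G.Walk u v, p.length ≤ 2 * i + 1 ∧ ∀ x ∈ p.support, x ∉ (S : Set G.V))
      (fun u v ⟨p, hp, hpS⟩ => ⟨p.reverse, by simpa using hp, by simpa using hpS⟩) B hB
    · obtain ⟨g⟩ : Nonempty (Fin k ↪ Q) :=
        Function.Embedding.nonempty_of_card_le (by simpa using hQ)
      have hinj : Function.Injective fun j => (g j : G.V) :=
        Subtype.val_injective.comp g.injective
      refine absurd (isDepthMinor_top_of_walks (S := S) (i := i) (fun j => (g j : G.V)) hinj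
        (fun j => hBS' _ (hQB (g j).2)) (hind.mono le_rfl ?_)
        fun j l hjl => hQR _ (g j).2 _ (g l).2 (hinj.ne hjl)) (hk G hG)
      rintro _ ⟨j, rfl⟩
      exact hQB (g j).2
    have hindJ : DistIndepIn G.G (S : Set G.V) (2 * i + 1) J := by
      intro u hu v hv huv p hp
      by_contra! h
      exact hJR u hu v hv huv ⟨p, h, hp⟩
    obtain h | ⟨T, hT, K, hKJ, hK, hKT⟩ :=
      hM (fun a w => w ∈ ballAvoiding G.G (S : Set G.V) (i + 1) a) J hJ
    · exact absurd (isDepthMinor_top_of_hasSubdividedClique (fun a ha => hBS' a (hJB ha)) hindJ h)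
        (hk G hG)
    refine ⟨S ∪ T, (Finset.card_union_le _ _).trans (by omega), K \ T,
      Finset.sdiff_subset.trans (hKJ.trans (hJB.trans hBA)), ?_, ?_, ?_⟩
    · rw [Finset.disjoint_union_right]
      exact ⟨hBS.mono_left (Finset.sdiff_subset.trans (hKJ.trans hJB)), Finset.sdiff_disjoint⟩
    · have := Finset.le_card_sdiff T K
      omega
    · intro u hu v hv huv p hp
      by_contra! hlen
      have hpS : ∀ x ∈ p.support, x ∉ (S : Set G.V) := fun x hx hxS =>
        hp x hx (Finset.mem_coe.2 (Finset.mem_union_left _ hxS))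
      exact hKT u (Finset.mem_sdiff.1 hu).1 v (Finset.mem_sdiff.1 hv).1 huv (p.getVert (i + 1))
        (fun h => hp _ (p.getVert_mem_support _) (Finset.mem_coe.2 (Finset.mem_union_right _ h)))
        (getVert_mem_ballAvoiding p hpS (min_le_left _ _))
        (getVert_mem_ballAvoiding_end p hpS (by omega))

theorem NowhereDense.uniformlyQuasiWide {C : Set FGraph} (hC : NowhereDense C) :
    UniformlyQuasiWide C := by
  classical
  intro r
  obtain ⟨s, hs⟩ := hC.exists_distIndepIn r
  refine ⟨s, fun m => ?_⟩
  obtain ⟨N, hN⟩ := hs m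
  refine ⟨N, fun G hG A hA => ?_⟩
  obtain ⟨S, hS, B, hBA, hBS, hB, hind⟩ := hN G hG A.toFinite.toFinset
    (by rwa [← Set.ncard_eq_toFinset_card])
  refine ⟨S, by rwa [Set.ncard_coe_finset], B, fun x hx => ⟨?_, Finset.disjoint_left.1 hBS hx⟩,
    by rwa [Set.ncard_coe_finset], hind.mono (by omega) subset_rfl⟩
  simpa using hBA hx

theorem UniformlyQuasiWide.nowhereDense {C : Set FGraph} (hC : UniformlyQuasiWide C) :
    NowhereDense C := by
  intro r
  obtain ⟨s, hs⟩ := hC (2 * r + 1)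
  obtain ⟨N, hN⟩ := hs (s + 2)
  refine ⟨N, fun G hG ⟨φ, hrad, hdisj, hadj⟩ => ?_⟩
  choose c hc hwalk using fun w => (hasRadiusLE_induce_iff _ _ _).1 (hrad w)
  have heq : ∀ {u v : Fin N} {x : G.V}, x ∈ φ u → x ∈ φ v → u = v := fun hu hv => by
    by_contra h
    exact Set.disjoint_left.1 (hdisj h) hu hv
  have hcinj : Function.Injective c := fun u v h => heq (hc u) (h ▸ hc v)
  obtain ⟨S, hS, B, hBA, hB, hind⟩ := hN G hG (Set.range c)
    (by rw [Set.ncard_range_of_injective hcinj]; simp)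
  let hit : Set (Fin N) := {w | ∃ x ∈ S, x ∈ φ w}
  have hhit : hit.ncard ≤ s := by
    have hex : ∀ w, ∃ x, w ∈ hit → x ∈ S ∧ x ∈ φ w := fun w => by
      by_cases hw : w ∈ hit
      · exact hw.imp fun x hx _ => hx
      · exact ⟨c w, fun h => absurd h hw⟩
    choose f hf using hex
    exact (Set.ncard_le_ncard_of_injOn f (fun w hw => (hf w hw).1)
      (fun u hu v hv h => heq (hf u hu).2 (h ▸ (hf v hv).2)) S.toFinite).trans hS
  have hpre : (c ⁻¹' B).ncard = B.ncard :=
    Set.ncard_preimage_of_injective_subset_range hcinj fun x hx => (hBA hx).1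
  have hdiff := Set.le_ncard_sdiff hit (c ⁻¹' B)
  obtain ⟨u, v, hu, hv, huv⟩ := (Set.one_lt_ncard_iff (Set.toFinite (c ⁻¹' B \ hit))).1 (by omega)
  obtain ⟨x, hx, y, hy, hxy⟩ := hadj u v huv
  obtain ⟨p, hp, hpφ⟩ := hwalk u x hx
  obtain ⟨q, hq, hqφ⟩ := hwalk v y hy
  have := hind (c u) hu.1 (c v) hv.1 (hcinj.ne huv) (p.append (Walk.cons hxy q.reverse)) (by
    intro z hz hzS
    rw [Walk.mem_support_append_iff, Walk.support_cons, List.mem_cons, Walk.support_reverse,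
      List.mem_reverse] at hz
    obtain hz | rfl | hz := hz
    · exact hu.2 ⟨z, hzS, hpφ z hz⟩
    · exact hu.2 ⟨z, hzS, hx⟩
    · exact hv.2 ⟨z, hzS, hqφ z hz⟩)
  rw [Walk.length_append, Walk.length_cons, Walk.length_reverse] at this
  omega

/-- A class is nowhere dense iff it is uniformly quasi-wide. -/
theorem stmt3 (C : Set FGraph) :
    NowhereDense C ↔ UniformlyQuasiWide C := by
  exact ⟨NowhereDense.uniformlyQuasiWide, UniformlyQuasiWide.nowhereDense⟩
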